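/- Let k ≥ 3 be an integer and let G be a connected finite graph with a set P of exactly k longest paths such that f(G,P) ≥ 1. Then (k-1)·(ℓ(G) − 1) ≥ 6·f(G,P), i.e., ℓ(G) ≥ 6·f(G,P)/(k-1) + 1. -/

import Mathlib

open SimpleGraph

/-- `w` is a longest path of `G`: it is a path and no path of `G` is longer. -/
def IsLongestPath {V : Type*} (G : SimpleGraph V) {u v : V} (w : G.Walk u v) : Prop :=
  w.IsPath ∧ ∀ (a b : V) (q : G.Walk a b), q.IsPath → q.length ≤ w.length

/-- The distance `d_G(x, V(w))` from a vertex `x` to the vertex set of a walk `w`. -/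
noncomputable def distToWalk {V : Type*} (G : SimpleGraph V) (x : V) {u v : V}
    (w : G.Walk u v) : ℕ :=
  sInf {d : ℕ | ∃ y ∈ w.support, G.dist x y = d}

/-- The path-distance-function `f(G, 𝒫)` of a family `𝒫` of paths of `G`. -/
noncomputable def pdf {V : Type*} (G : SimpleGraph V) {k : ℕ}
    (P : Fin k → Σ u : V, Σ v : V, G.Walk u v) : ℕ :=
  sInf {s : ℕ | ∃ x : V, s = ∑ i, distToWalk G x (P i).2.2}

section
variable {V : Type*} {R : V → V → Prop}

theorem List.IsChain.length_le_of_pendant {N : ℕ}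
    (hR : ∀ a b, R a b → R b a) (hmax : ∀ l : List V, l.IsChain R → l.Nodup → l.length ≤ N)
    {B₁ B₂ T : List V} {x : V} (hB : (B₁ ++ x :: B₂).IsChain R) (hBn : (B₁ ++ x :: B₂).Nodup)
    (hN : (B₁ ++ x :: B₂).length = N) (hT : (x :: T).IsChain R) (hTn : T.Nodup)
    (hd : ∀ y ∈ T, y ∉ B₁ ++ x :: B₂) :
    T.length ≤ B₁.length ∧ T.length ≤ B₂.length := by
  have hrev : (T.reverse ++ [x]).IsChain R := by
    have := List.isChain_reverse.2 (hT.imp fun a b h => hR a b h)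
    simpa using this
  have h₁ := hmax (B₁ ++ x :: T) (by
    rw [List.isChain_split] at hB ⊢; exact ⟨hB.1, hT⟩) (by grind)
  have h₂ := hmax (T.reverse ++ x :: B₂) (by
    rw [List.isChain_split] at hB ⊢; exact ⟨hrev, hB.2⟩) (by
    rw [List.nodup_append] at hBn ⊢
    refine ⟨List.nodup_reverse.2 hTn, hBn.2.1, ?_⟩
    intro a ha b hb hab
    exact hd a (List.mem_reverse.1 ha) (by simp [hab, List.mem_cons.1 hb]))
  grind

theorem List.IsChain.three_mul_length_le_of_ear {N : ℕ}
    (hR : ∀ a b, R a b → R b a) (hmax : ∀ l : List V, l.IsChain R → l.Nodup → l.length ≤ N)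
    {B₁ B₂ B₃ E : List V} {x y : V} (hB : (B₁ ++ x :: (B₂ ++ y :: B₃)).IsChain R)
    (hBn : (B₁ ++ x :: (B₂ ++ y :: B₃)).Nodup)
    (hN : (B₁ ++ x :: (B₂ ++ y :: B₃)).length = N)
    (hE : (x :: (E ++ [y])).IsChain R) (hEn : E.Nodup)
    (hd : ∀ z ∈ E, z ∉ B₁ ++ x :: (B₂ ++ y :: B₃)) :
    3 * E.length + 2 ≤ N := by
  have hx : (x :: E).IsChain R := hE.left_of_append (l₁ := x :: E)
  have hy : (y :: E.reverse).IsChain R := by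
    have := List.isChain_reverse.2 (hE.tail.imp fun a b h => hR a b h)
    simpa using this
  have h₁ := (hB.length_le_of_pendant hR hmax hBn hN hx hEn hd).1
  have e : B₁ ++ x :: (B₂ ++ y :: B₃) = (B₁ ++ x :: B₂) ++ y :: B₃ := by simp
  have h₃ := (List.IsChain.length_le_of_pendant hR hmax (e ▸ hB) (e ▸ hBn) (e ▸ hN) hy
    (List.nodup_reverse.2 hEn) (by grind)).2
  have h₂ := hmax (B₁ ++ x :: (E ++ y :: B₃)) (by
    rw [List.isChain_split] at hB ⊢
    refine ⟨hB.1, ?_⟩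
    have hB' := hB.2
    rw [← List.cons_append, List.isChain_split] at hB' ⊢
    exact ⟨by simpa using hE, hB'.2⟩) (by grind)
  grind

theorem List.IsChain.three_mul_sub_le_of_gap {N : ℕ}
    (hR : ∀ a b, R a b → R b a) (hmax : ∀ l : List V, l.IsChain R → l.Nodup → l.length ≤ N)
    {A B : List V} (hA : A.IsChain R) (hAn : A.Nodup)
    (hB : B.IsChain R) (hBn : B.Nodup) (hBN : B.length = N) {i j : ℕ} (hij : i < j)
    (hj : j < A.length) (hiB : A[i] ∈ B) (hjB : A[j] ∈ B)
    (hgap : ∀ n (h : n < A.length), i < n → n < j → A[n] ∉ B) :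
    3 * (j - i) ≤ N + 1 := by
  obtain ⟨E, hEl, hsub, hEd⟩ : ∃ E : List V, E.length + 1 = j - i ∧
      (A[i] :: (E ++ [A[j]])) <:+: A ∧ ∀ z ∈ E, z ∉ B := by
    refine ⟨(A.drop (i + 1)).take (j - i - 1), by simp; omega, ?_, ?_⟩
    · refine ⟨A.take i, A.drop (j + 1), ?_⟩
      have h₁ : A = A.take i ++ A[i] :: A.drop (i + 1) := by simp
      have h₂ : A.drop (i + 1) = (A.drop (i + 1)).take (j - i - 1) ++ A.drop j := by
        conv_lhs => rw [← List.take_append_drop (j - i - 1) (A.drop (i + 1))]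
        rw [List.drop_drop]; congr 2; omega
      have h₃ : A.drop j = A[j] :: A.drop (j + 1) := List.drop_eq_getElem_cons hj
      conv_rhs => rw [h₁, h₂, h₃]
      simp
    · intro z hz
      obtain ⟨n, hn, rfl⟩ := List.getElem_of_mem hz
      simp only [List.length_take, List.length_drop] at hn
      simpa using hgap (i + 1 + n) (by omega) (by omega) (by omega)
  have hc := hA.infix hsub
  have hn : (A[i] :: (E ++ [A[j]])).Nodup := hAn.sublist hsub.sublist
  have hne : A[i] ≠ A[j] := by grind
  have hEn : E.Nodup := by grind
  generalize A[i] = x at *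
  generalize A[j] = y at *
  have hc' : (y :: (E.reverse ++ [x])).IsChain R := by
    have := List.isChain_reverse.2 (hc.imp fun a b h => hR a b h)
    simpa using this
  obtain ⟨B₁, B₂, rfl⟩ := List.append_of_mem hiB
  have : y ∈ B₁ ∨ y ∈ B₂ := by grind
  rcases this with h | h
  · obtain ⟨C₁, C₂, rfl⟩ := List.append_of_mem h
    simp only [List.append_assoc, List.cons_append] at *
    have := hB.three_mul_length_le_of_ear hR hmax hBn hBN hc' (List.nodup_reverse.2 hEn) (by grind)
    grind
  · obtain ⟨C₁, C₂, rfl⟩ := List.append_of_mem h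
    have := hB.three_mul_length_le_of_ear hR hmax hBn hBN hc hEn hEd
    omega

theorem List.IsChain.two_mul_lt_of_first_hit {N : ℕ}
    (hR : ∀ a b, R a b → R b a) (hmax : ∀ l : List V, l.IsChain R → l.Nodup → l.length ≤ N)
    {A B : List V} (hA : A.IsChain R) (hAn : A.Nodup)
    (hB : B.IsChain R) (hBn : B.Nodup) (hBN : B.length = N) {i : ℕ}
    (hi : i < A.length) (hiB : A[i] ∈ B)
    (hfirst : ∀ n (h : n < A.length), n < i → A[n] ∉ B) :
    2 * i < N := by
  have hc : (A[i] :: (A.take i).reverse).IsChain R := by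
    have := List.isChain_reverse.2 ((hA.infix (List.take_prefix (i + 1) A).isInfix).imp
      fun a b h => hR a b h)
    rw [List.take_succ_eq_append_getElem hi] at this
    simpa only [List.reverse_append, List.reverse_singleton, List.singleton_append] using this
  have hd : ∀ z ∈ (A.take i).reverse, z ∉ B := by
    intro z hz
    obtain ⟨n, hn, rfl⟩ := List.getElem_of_mem (List.mem_reverse.1 hz)
    simp only [List.length_take] at hn
    simpa using hfirst n (by omega) (by omega)
  have hn : (A.take i).reverse.Nodup := List.nodup_reverse.2 (hAn.sublist (List.take_sublist _ _))
  have hl : (A.take i).reverse.length = i := by simp; omega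
  obtain ⟨B₁, B₂, hBe⟩ := List.append_of_mem hiB
  subst hBN
  have := List.IsChain.length_le_of_pendant hR hmax (hBe ▸ hB) (hBe ▸ hBn) (by rw [hBe]) hc hn
    (hBe ▸ hd)
  rw [hl] at this
  have := congrArg List.length hBe
  simp only [List.length_append, List.length_cons] at this
  omega

/-- With `m` the middle index, either both `m` and `m + 1` lie in a short gap, or `m` is a hit. -/
theorem List.IsChain.exists_hits_around_middle {ℓ : ℕ}
    (hR : ∀ a b, R a b → R b a) (hmax : ∀ l : List V, l.IsChain R → l.Nodup → l.length ≤ ℓ + 1)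
    {A B : List V} (hA : A.IsChain R) (hAn : A.Nodup) (hAN : A.length = ℓ + 1)
    (hB : B.IsChain R) (hBn : B.Nodup) (hBN : B.length = ℓ + 1)
    (hAB : ∃ z ∈ A, z ∈ B) :
    (∃ h : ℓ / 2 < A.length, A[ℓ / 2] ∈ B) ∨ ∃ i j, ∃ hj : j < A.length, ∃ _ : i < j,
      A[i] ∈ B ∧ A[j] ∈ B ∧ i ≤ ℓ / 2 ∧ ℓ / 2 < j ∧ 3 * (j - i) ≤ ℓ + 2 := by
  classical
  by_cases hm : ∃ h : ℓ / 2 < A.length, A[ℓ / 2] ∈ B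
  · exact .inl hm
  right
  have hlow : ∀ {A : List V}, A.IsChain R → A.Nodup → (∃ z ∈ A, z ∈ B) →
      ∃ p, ∃ hp : p < A.length, A[p] ∈ B ∧ 2 * p ≤ ℓ := by
    intro A hA hAn ⟨z, hzA, hzB⟩
    obtain ⟨n, hn, rfl⟩ := List.getElem_of_mem hzA
    have hex : ∃ n, ∃ hn : n < A.length, A[n] ∈ B := ⟨n, hn, hzB⟩
    obtain ⟨hp, hpB⟩ := Nat.find_spec hex
    refine ⟨Nat.find hex, hp, hpB, ?_⟩
    have := hA.two_mul_lt_of_first_hit hR hmax hAn hB hBn hBN hp hpB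
      fun n h hlt hmem => Nat.find_min hex hlt ⟨h, hmem⟩
    omega
  obtain ⟨p, hp, hpB, hp2⟩ := hlow hA hAn hAB
  obtain ⟨q, hq, hqB, hq2⟩ := hlow (A := A.reverse)
    (List.isChain_reverse.2 (hA.imp fun a b h => hR a b h)) (List.nodup_reverse.2 hAn) (by simpa)
  rw [List.getElem_reverse] at hqB
  rw [List.length_reverse] at hq
  let hit : ℕ → Prop := fun n => ∃ hn : n < A.length, A[n] ∈ B
  have hqe : ∃ n, ℓ / 2 < n ∧ hit n := by
    refine ⟨A.length - 1 - q, ?_, by omega, hqB⟩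
    by_contra hle
    have : A.length - 1 - q = ℓ / 2 := by omega
    exact hm ⟨by omega, by simpa only [this] using hqB⟩
  obtain ⟨hjm, hj, hjB⟩ := Nat.find_spec hqe
  have hjmin := fun n => Nat.find_min hqe (m := n)
  generalize Nat.find hqe = j at *
  have hpi : hit p := ⟨hp, hpB⟩
  have hple : p ≤ ℓ / 2 := by omega
  obtain ⟨hi, hiB⟩ := Nat.findGreatest_spec hple hpi
  have hile := Nat.findGreatest_le (P := hit) (ℓ / 2)
  have himax := fun n => Nat.findGreatest_is_greatest (P := hit) (n := ℓ / 2) (k := n)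
  generalize Nat.findGreatest hit (ℓ / 2) = i at *
  refine ⟨i, j, hj, by omega, hiB, hjB, hile, hjm, ?_⟩
  refine hA.three_mul_sub_le_of_gap hR hmax hAn hB hBn hBN (by omega) hj hiB hjB ?_
  intro n hn hin hnj hmem
  by_cases hnm : n ≤ ℓ / 2
  · exact himax n hin hnm ⟨hn, hmem⟩
  · exact hjmin n hnj ⟨by omega, hn, hmem⟩

end

namespace IsLongestPath

variable {V : Type*} {G : SimpleGraph V}

theorem length_le_of_isChain {u v : V} {w : G.Walk u v} (hw : IsLongestPath G w) (l : List V)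
    (hl : l.IsChain G.Adj) (hn : l.Nodup) : l.length ≤ w.length + 1 := by
  rcases eq_or_ne l [] with rfl | hne
  · simp
  have := hw.2 _ _ (Walk.ofSupport l hne hl)
    ((Walk.isPath_def _).2 (by rwa [Walk.support_ofSupport]))
  rw [Walk.length_ofSupport] at this
  omega

theorem length_eq {u v u' v' : V} {w : G.Walk u v} {w' : G.Walk u' v'}
    (hw : IsLongestPath G w) (hw' : IsLongestPath G w') : w'.length = w.length :=
  le_antisymm (hw.2 _ _ _ hw'.1) (hw'.2 _ _ _ hw.1)

/-- Any two longest paths of a connected graph share a vertex. -/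
theorem exists_mem_support (hG : G.Connected) {u v u' v' : V} {w : G.Walk u v}
    {w' : G.Walk u' v'} (hw : IsLongestPath G w) (hw' : IsLongestPath G w') :
    ∃ z ∈ w.support, z ∈ w'.support := by
  classical
  by_contra! hdisj
  have hex : ∃ n, ∃ a ∈ w.support, ∃ b ∈ w'.support, G.dist a b = n :=
    ⟨_, u, w.start_mem_support, u', w'.start_mem_support, rfl⟩
  obtain ⟨a, ha, b, hb, hab⟩ := Nat.find_spec hex
  have hmin : ∀ c ∈ w.support, ∀ d ∈ w'.support, G.dist a b ≤ G.dist c d :=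
    fun c hc d hd => hab ▸ Nat.find_min' hex ⟨c, hc, d, hd, rfl⟩
  obtain ⟨q, hq, hql⟩ := hG.exists_path_of_dist a b
  have hne : a ≠ b := fun h => hdisj a ha (h ▸ hb)
  have hqA : ∀ c ∈ q.support, c ∈ w.support → c = a := by
    intro c hc hcA
    by_contra hca
    have h₁ := hmin c hcA b hb
    have h₂ := dist_le (q.dropUntil c hc)
    have h₃ := congrArg Walk.length (q.take_spec hc)
    rw [Walk.length_append] at h₃
    have h₄ : (q.takeUntil c hc).length ≠ 0 := fun h => hca (Walk.eq_of_length_eq_zero h).symm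
    omega
  have hqB : ∀ c ∈ q.support, c ∈ w'.support → c = b := by
    intro c hc hcB
    by_contra hcb
    have h₁ := hmin a ha c hcB
    have h₂ := dist_le (q.takeUntil c hc)
    have h₃ := congrArg Walk.length (q.take_spec hc)
    rw [Walk.length_append] at h₃
    have h₄ : (q.dropUntil c hc).length ≠ 0 := fun h => hcb (Walk.eq_of_length_eq_zero h)
    omega
  obtain ⟨Q, hQ⟩ : ∃ Q, q.support = Q ++ [b] :=
    ⟨q.support.dropLast, by
      conv_lhs => rw [← List.dropLast_append_getLast q.support_ne_nil, Walk.getLast_support]⟩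
  obtain ⟨Q', rfl⟩ : ∃ Q', Q = a :: Q' := by
    rw [← Walk.cons_tail_support] at hQ
    cases Q with
    | nil => simp only [List.nil_append, List.cons.injEq] at hQ; exact absurd hQ.1 hne
    | cons c Q' => exact ⟨Q', by simp only [List.cons_append, List.cons.injEq] at hQ; rw [hQ.1]⟩
  have hqc := q.isChain_adj_support
  have hqn := hq.support_nodup
  rw [hQ] at hqc hqn hqA hqB
  have hqr : (b :: (Q'.reverse ++ [a])).IsChain G.Adj := by
    have := List.isChain_reverse.2 (hqc.imp fun _ _ h => h.symm)
    simpa using this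
  obtain ⟨B₁, B₂, hB⟩ := List.append_of_mem hb
  have key : ∀ A₁ A₂ : List V, (A₁ ++ a :: A₂).IsChain G.Adj → (A₁ ++ a :: A₂).Nodup →
      (∀ z ∈ A₁ ++ a :: A₂, z ∈ w.support) →
      Q'.length + 1 + A₂.length ≤ B₁.length ∧ Q'.length + 1 + A₂.length ≤ B₂.length := by
    intro A₁ A₂ hA hAn hAw
    have hT : (b :: (Q'.reverse ++ a :: A₂)).IsChain G.Adj := by
      rw [← List.cons_append, List.isChain_split]
      exact ⟨by simpa using hqr, (List.isChain_split.1 hA).2⟩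
    have hTn : (Q'.reverse ++ a :: A₂).Nodup := by
      rw [List.nodup_append]
      refine ⟨List.nodup_reverse.2 (by grind), by grind, ?_⟩
      rintro y hy z hz rfl
      have hyQ := List.mem_reverse.1 hy
      have := hqA y (by simp [hyQ]) (hAw y (List.mem_append_right _ hz))
      subst this
      simp [hyQ] at hqn
    have hTd : ∀ z ∈ Q'.reverse ++ a :: A₂, z ∉ w'.support := by
      intro z hz hzB
      rcases List.mem_append.1 hz with h | h
      · have hzQ := List.mem_reverse.1 h
        have := hqB z (by simp [hzQ]) hzB
        subst this
        grind
      · exact hdisj z (hAw z (List.mem_append_right _ h)) hzB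
    have := List.IsChain.length_le_of_pendant (fun _ _ h => h.symm) hw'.length_le_of_isChain
      (hB ▸ w'.isChain_adj_support) (hB ▸ hw'.1.support_nodup)
      (by rw [← hB, Walk.length_support]) hT hTn (hB ▸ hTd)
    simp only [List.length_append, List.length_reverse, List.length_cons] at this
    omega
  obtain ⟨A₁, A₂, hA⟩ := List.append_of_mem ha
  have hAc := w.isChain_adj_support
  have hAn := hw.1.support_nodup
  have k₁ := key A₁ A₂ (hA ▸ hAc) (hA ▸ hAn) (fun z hz => hA ▸ hz)
  have hrev : A₂.reverse ++ a :: A₁.reverse = w.support.reverse := by simp [hA]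
  have k₂ := key A₂.reverse A₁.reverse
    (hrev ▸ List.isChain_reverse.2 (hAc.imp fun _ _ h => h.symm))
    (hrev ▸ List.nodup_reverse.2 hAn) (fun z hz => by simpa [hrev] using hz)
  have l₁ := congrArg List.length hA
  have l₂ := congrArg List.length hB
  have l₃ := hw.length_eq hw'
  simp only [Walk.length_support, List.length_append, List.length_cons] at l₁ l₂
  rw [List.length_reverse] at k₂
  omega

end IsLongestPath

theorem SimpleGraph.Walk.dist_getVert_le {V : Type*} {G : SimpleGraph V} {u v : V}
    (w : G.Walk u v) {i j : ℕ} (hij : i ≤ j) : G.dist (w.getVert i) (w.getVert j) ≤ j - i := by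
  have h := dist_le ((w.drop i).take (j - i))
  have e : (w.drop i).getVert (j - i) = w.getVert j := by
    rw [Walk.drop_getVert, Nat.add_sub_cancel' hij]
  calc G.dist (w.getVert i) (w.getVert j)
      = G.dist (w.getVert i) ((w.drop i).getVert (j - i)) := by rw [e]
    _ ≤ ((w.drop i).take (j - i)).length := h
    _ ≤ j - i := by simp

theorem distToWalk_le {V : Type*} (G : SimpleGraph V) (x : V) {u v : V} (w : G.Walk u v)
    {y : V} (hy : y ∈ w.support) : distToWalk G x w ≤ G.dist x y :=
  Nat.sInf_le ⟨y, hy, rfl⟩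

theorem pdf_le {V : Type*} (G : SimpleGraph V) {k : ℕ}
    (P : Fin k → Σ u : V, Σ v : V, G.Walk u v) (x : V) :
    pdf G P ≤ ∑ i, distToWalk G x (P i).2.2 :=
  Nat.sInf_le ⟨x, rfl⟩

namespace IsLongestPath

variable {V : Type*} {G : SimpleGraph V}

theorem hits_around_middle (hG : G.Connected) {u v u' v' : V} {w : G.Walk u v}
    {w' : G.Walk u' v'} (hw : IsLongestPath G w) (hw' : IsLongestPath G w') :
    w.getVert (w.length / 2) ∈ w'.support ∨ ∃ i j, w.getVert i ∈ w'.support ∧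
      w.getVert j ∈ w'.support ∧ i ≤ w.length / 2 ∧ w.length / 2 < j ∧
      3 * (j - i) ≤ w.length + 2 := by
  have hl := hw.length_eq hw'
  rcases w.isChain_adj_support.exists_hits_around_middle (fun _ _ h => h.symm)
      hw.length_le_of_isChain hw.1.support_nodup w.length_support w'.isChain_adj_support
      hw'.1.support_nodup (by rw [Walk.length_support, hl]) (exists_mem_support hG hw hw') with
    ⟨h, hm⟩ | ⟨i, j, hj, hij, hiB, hjB, him, hmj, h3⟩
  · rw [Walk.support_getElem_eq_getVert] at hm
    exact .inl hm
  · rw [Walk.support_getElem_eq_getVert] at hiB hjB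
    exact .inr ⟨i, j, hiB, hjB, him, hmj, h3⟩

theorem three_mul_distToWalk_add_le (hG : G.Connected) {u v u' v' : V} {w : G.Walk u v}
    {w' : G.Walk u' v'} (hw : IsLongestPath G w) (hw' : IsLongestPath G w')
    (hl : 4 ≤ w.length) :
    3 * (distToWalk G (w.getVert (w.length / 2)) w' +
      distToWalk G (w.getVert (w.length / 2 + 1)) w') + 1 ≤ w.length := by
  rcases hits_around_middle hG hw hw' with hm | ⟨i, j, hi, hj, him, hmj, h3⟩
  · have h₁ := distToWalk_le G (w.getVert (w.length / 2)) w' hm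
    have h₂ := distToWalk_le G (w.getVert (w.length / 2 + 1)) w' hm
    have h₃ := w.dist_getVert_le (Nat.le_succ (w.length / 2))
    rw [dist_self] at h₁
    rw [dist_comm] at h₂
    simp only [Nat.succ_eq_add_one] at h₃
    omega
  · have h₁ := distToWalk_le G (w.getVert (w.length / 2)) w' hi
    have h₂ := distToWalk_le G (w.getVert (w.length / 2 + 1)) w' hj
    have h₃ := w.dist_getVert_le him
    have h₄ := w.dist_getVert_le (Nat.succ_le_of_lt hmj)
    rw [dist_comm] at h₁
    simp only [Nat.succ_eq_add_one] at h₄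
    omega

theorem distToWalk_middle_eq_zero (hG : G.Connected) {u v u' v' : V} {w : G.Walk u v}
    {w' : G.Walk u' v'} (hw : IsLongestPath G w) (hw' : IsLongestPath G w')
    (hl : w.length < 4) : distToWalk G (w.getVert (w.length / 2)) w' = 0 := by
  have hm : w.getVert (w.length / 2) ∈ w'.support := by
    rcases hits_around_middle hG hw hw' with hm | ⟨i, j, hi, hj, him, hmj, h3⟩
    · exact hm
    · rwa [show i = w.length / 2 by omega] at hi
  have := distToWalk_le G (w.getVert (w.length / 2)) w' hm
  rw [dist_self] at this
  omega

end IsLongestPath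

/-- (*) in the proof of Theorem 3: if `f(G,𝒫) ≥ 1`, then
`ℓ(G) ≥ 6·f(G,𝒫)/(k-1) + 1`, i.e. `(k-1)·(ℓ(G) - 1) ≥ 6·f(G,𝒫)`;
here `ℓ(G)` is the length of the longest path `P 0`. -/
theorem length_lower_bound_k {V : Type*} [Fintype V] (G : SimpleGraph V)
    (hG : G.Connected) (k : ℕ) (hk : 3 ≤ k)
    (P : Fin k → Σ u : V, Σ v : V, G.Walk u v)
    (hinj : Function.Injective P) (hlong : ∀ i, IsLongestPath G (P i).2.2)
    (hf : 1 ≤ pdf G P) :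
    6 * pdf G P + (k - 1) ≤ (k - 1) * (P ⟨0, by omega⟩).2.2.length := by
  set i₀ : Fin k := ⟨0, by omega⟩
  set w := (P i₀).2.2
  have hw : IsLongestPath G w := hlong i₀
  rcases lt_or_ge w.length 4 with hl | hl
  · have h := pdf_le G P (w.getVert (w.length / 2))
    rw [Finset.sum_eq_zero fun i _ => hw.distToWalk_middle_eq_zero hG (hlong i) hl] at h
    omega
  · have h₁ := pdf_le G P (w.getVert (w.length / 2))
    have h₂ := pdf_le G P (w.getVert (w.length / 2 + 1))
    have hself : ∀ n, distToWalk G (w.getVert n) (P i₀).2.2 = 0 := fun n => by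
      have := distToWalk_le G (w.getVert n) w (w.getVert_mem_support n)
      rw [dist_self] at this
      exact Nat.le_zero.1 this
    rw [← Finset.add_sum_erase _ _ (Finset.mem_univ i₀), hself, zero_add] at h₁ h₂
    have hsum := Finset.sum_le_card_nsmul (Finset.univ.erase i₀)
      (fun i => 3 * (distToWalk G (w.getVert (w.length / 2)) (P i).2.2 +
        distToWalk G (w.getVert (w.length / 2 + 1)) (P i).2.2) + 1) w.length
      fun i _ => hw.three_mul_distToWalk_add_le hG (hlong i) hl
    simp only [Finset.sum_add_distrib, ← Finset.mul_sum, Finset.sum_const, smul_eq_mul, mul_one,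
      Finset.card_erase_of_mem (Finset.mem_univ i₀), Finset.card_univ, Fintype.card_fin] at hsum
    omega
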